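/- arXiv:2403.03763 — 2 statements merged into one kernel-verified Lean document; each statement's English description precedes it below -/
import Mathlib

section
/- The map φ : Cay(A[t], t) → A[X;*]^fl defined by φ(p(t), q(t)) = p(X²) + q(X²)·X (where p(X²) denotes Σ_i a_i X^{2i} for p(t) = Σ_i a_i t^i) is a bijective K-algebra homomorphism satisfying φ((p(t), q(t))*) = α(φ(p(t), q(t))); in particular Cay(A[t], t) and A[X;*]^fl are isomorphic as *-algebras. -/
/-- `tau n a b = ab` if `n` is even and `ba` if `n` is odd. -/
def tau {A : Type*} [NonAssocRing A] (n : ℕ) (a b : A) : A :=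
  if Even n then a * b else b * a

/-- The `m`-fold iterate `*^m` of the involution `*`. -/
def starIter {A : Type*} [NonAssocRing A] [StarRing A] : ℕ → A → A
  | 0, a => a
  | m+1, a => star (starIter m a)

/-- The multiplication of the flipped non-associative skew polynomial ring `B = A[X;*]^fl`:
the biadditive extension of `(aX^m)(bX^n) = τ_n(a, *^m(b)) X^{m+n}`. Polynomials are
represented as finitely supported functions `ℕ →₀ A`. -/
noncomputable def fmul {A : Type*} [NonAssocRing A] [StarRing A] (p q : ℕ →₀ A) : ℕ →₀ A :=
  p.sum fun m a => q.sum fun n b => Finsupp.single (m+n) (tau n a (starIter m b))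

/-- The map `α : B → B`, `α(Σ_i a_i X^i) = Σ_i (−1)^i *^{i+1}(a_i) X^i`. -/
noncomputable def alphaMap {A : Type*} [NonAssocRing A] [StarRing A] (p : ℕ →₀ A) : ℕ →₀ A :=
  p.sum fun i a => Finsupp.single i ((-1 : ℤ) ^ i • starIter (i+1) a)

/-- The map `β : B → B`, `β(Σ_i a_i X^i) = Σ_i *^{i+1}(a_i) X^i`. -/
noncomputable def betaMap {A : Type*} [NonAssocRing A] [StarRing A] (p : ℕ →₀ A) : ℕ →₀ A :=
  p.sum fun i a => Finsupp.single i (starIter (i+1) a)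

/-- The multiplication of the ordinary polynomial ring `A[t]`:
`(a t^m)(b t^n) = (ab) t^{m+n}`. -/
noncomputable def pmul {A : Type*} [NonAssocRing A] (p q : ℕ →₀ A) : ℕ →₀ A :=
  p.sum fun m a => q.sum fun n b => Finsupp.single (m + n) (a * b)

/-- The involution of `A[t]` extending `*` coefficientwise (so `t* = t`). -/
noncomputable def pstar {A : Type*} [NonAssocRing A] [StarRing A] (p : ℕ →₀ A) : ℕ →₀ A :=
  Finsupp.mapRange (star : A → A) (star_zero A) p

/-- Multiplication by the scalar `t ∈ K[t]` on `A[t]`. -/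
noncomputable def tshift {A : Type*} [NonAssocRing A] (p : ℕ →₀ A) : ℕ →₀ A :=
  p.sum fun n a => Finsupp.single (n + 1) a

/-- The product of the Cayley double `Cay(A[t], t) = A[t] ⊕ A[t]`:
`(p,q)(r,s) = (pr + t s*q, sp + qr*)`. -/
noncomputable def cayPolyMul {A : Type*} [NonAssocRing A] [StarRing A]
    (x y : (ℕ →₀ A) × (ℕ →₀ A)) : (ℕ →₀ A) × (ℕ →₀ A) :=
  (pmul x.1 y.1 + tshift (pmul (pstar y.2) x.2), pmul y.2 x.1 + pmul x.2 (pstar y.1))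

/-- The involution of `Cay(A[t], t)`: `(p,q)* = (p*, −q)`. -/
noncomputable def cayPolyStar {A : Type*} [NonAssocRing A] [StarRing A]
    (x : (ℕ →₀ A) × (ℕ →₀ A)) : (ℕ →₀ A) × (ℕ →₀ A) :=
  (pstar x.1, -x.2)

/-- `p(t) ↦ p(X²)`: sends `Σ_i a_i t^i` to `Σ_i a_i X^{2i}`. -/
noncomputable def evenEmbed {A : Type*} [NonAssocRing A] (p : ℕ →₀ A) : ℕ →₀ A :=
  p.sum fun i a => Finsupp.single (2 * i) a

/-- `q(t) ↦ q(X²)·X`: sends `Σ_i a_i t^i` to `Σ_i a_i X^{2i+1}`. -/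
noncomputable def oddEmbed {A : Type*} [NonAssocRing A] (p : ℕ →₀ A) : ℕ →₀ A :=
  p.sum fun i a => Finsupp.single (2 * i + 1) a

section Additivity

variable {A : Type*} [NonAssocRing A]

theorem tau_zero_left (n : ℕ) (b : A) : tau n 0 b = 0 := by simp [tau]

theorem tau_zero_right (n : ℕ) (a : A) : tau n a 0 = 0 := by simp [tau]

theorem tau_add_left (n : ℕ) (a a' b : A) : tau n (a + a') b = tau n a b + tau n a' b := by
  unfold tau
  split_ifs <;> simp [add_mul, mul_add]

theorem tau_add_right (n : ℕ) (a b b' : A) : tau n a (b + b') = tau n a b + tau n a b' := by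
  unfold tau
  split_ifs <;> simp [add_mul, mul_add]

theorem tau_two_mul (n : ℕ) (a b : A) : tau (2 * n) a b = a * b := by simp [tau]

theorem tau_two_mul_add_one (n : ℕ) (a b : A) : tau (2 * n + 1) a b = b * a := by simp [tau]

@[simp] theorem evenEmbed_zero : evenEmbed (0 : ℕ →₀ A) = 0 := Finsupp.sum_zero_index

@[simp] theorem oddEmbed_zero : oddEmbed (0 : ℕ →₀ A) = 0 := Finsupp.sum_zero_index

@[simp] theorem tshift_zero : tshift (0 : ℕ →₀ A) = 0 := Finsupp.sum_zero_index

@[simp] theorem evenEmbed_single (n : ℕ) (a : A) :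
    evenEmbed (Finsupp.single n a) = Finsupp.single (2 * n) a :=
  Finsupp.sum_single_index (Finsupp.single_zero _)

@[simp] theorem oddEmbed_single (n : ℕ) (a : A) :
    oddEmbed (Finsupp.single n a) = Finsupp.single (2 * n + 1) a :=
  Finsupp.sum_single_index (Finsupp.single_zero _)

@[simp] theorem tshift_single (n : ℕ) (a : A) :
    tshift (Finsupp.single n a) = Finsupp.single (n + 1) a :=
  Finsupp.sum_single_index (Finsupp.single_zero _)

theorem evenEmbed_add (p q : ℕ →₀ A) : evenEmbed (p + q) = evenEmbed p + evenEmbed q :=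
  Finsupp.sum_add_index' (fun _ => Finsupp.single_zero _) fun _ => Finsupp.single_add _

theorem oddEmbed_add (p q : ℕ →₀ A) : oddEmbed (p + q) = oddEmbed p + oddEmbed q :=
  Finsupp.sum_add_index' (fun _ => Finsupp.single_zero _) fun _ => Finsupp.single_add _

theorem tshift_add (p q : ℕ →₀ A) : tshift (p + q) = tshift p + tshift q :=
  Finsupp.sum_add_index' (fun _ => Finsupp.single_zero _) fun _ => Finsupp.single_add _

theorem oddEmbed_neg (p : ℕ →₀ A) : oddEmbed (-p) = -oddEmbed p :=
  eq_neg_of_add_eq_zero_left (by rw [← oddEmbed_add, neg_add_cancel, oddEmbed_zero])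

@[simp] theorem pmul_zero_left (q : ℕ →₀ A) : pmul 0 q = 0 := Finsupp.sum_zero_index

@[simp] theorem pmul_zero_right (p : ℕ →₀ A) : pmul p 0 = 0 := by simp [pmul]

theorem pmul_add_left (p p' q : ℕ →₀ A) : pmul (p + p') q = pmul p q + pmul p' q :=
  Finsupp.sum_add_index' (by simp) fun _ _ _ => by
    simp [add_mul, Finsupp.sum_add]

theorem pmul_add_right (p q q' : ℕ →₀ A) : pmul p (q + q') = pmul p q + pmul p q' := by
  unfold pmul
  rw [← Finsupp.sum_add]
  refine Finsupp.sum_congr fun m _ => Finsupp.sum_add_index' (by simp) fun _ _ _ => ?_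
  rw [mul_add, Finsupp.single_add]

@[simp] theorem pmul_single (m n : ℕ) (a b : A) :
    pmul (Finsupp.single m a) (Finsupp.single n b) = Finsupp.single (m + n) (a * b) := by
  simp [pmul]

theorem evenEmbed_smul {K : Type*} [Semiring K] [Module K A] (k : K) (p : ℕ →₀ A) :
    evenEmbed (k • p) = k • evenEmbed p := by
  induction p using Finsupp.induction_linear with
  | zero => simp
  | add p q hp hq => simp only [smul_add, evenEmbed_add, hp, hq]
  | single n a => simp

theorem oddEmbed_smul {K : Type*} [Semiring K] [Module K A] (k : K) (p : ℕ →₀ A) :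
    oddEmbed (k • p) = k • oddEmbed p := by
  induction p using Finsupp.induction_linear with
  | zero => simp
  | add p q hp hq => simp only [smul_add, oddEmbed_add, hp, hq]
  | single n a => simp

theorem evenEmbed_apply_two_mul (p : ℕ →₀ A) (i : ℕ) : evenEmbed p (2 * i) = p i := by
  induction p using Finsupp.induction_linear with
  | zero => simp
  | add p q hp hq => simp [evenEmbed_add, hp, hq]
  | single n a => simp [Finsupp.single_apply]

theorem oddEmbed_apply_two_mul_add_one (p : ℕ →₀ A) (i : ℕ) :
    oddEmbed p (2 * i + 1) = p i := by
  induction p using Finsupp.induction_linear with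
  | zero => simp
  | add p q hp hq => simp [oddEmbed_add, hp, hq]
  | single n a => simp [Finsupp.single_apply]

theorem evenEmbed_apply_two_mul_add_one (p : ℕ →₀ A) (i : ℕ) :
    evenEmbed p (2 * i + 1) = 0 := by
  induction p using Finsupp.induction_linear with
  | zero => simp
  | add p q hp hq => simp [evenEmbed_add, hp, hq]
  | single n a => rw [evenEmbed_single, Finsupp.single_eq_of_ne (by lia)]

theorem oddEmbed_apply_two_mul (p : ℕ →₀ A) (i : ℕ) : oddEmbed p (2 * i) = 0 := by
  induction p using Finsupp.induction_linear with
  | zero => simp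
  | add p q hp hq => simp [oddEmbed_add, hp, hq]
  | single n a => rw [oddEmbed_single, Finsupp.single_eq_of_ne (by lia)]

theorem bijective_evenEmbed_add_oddEmbed :
    Function.Bijective
      (fun x : (ℕ →₀ A) × (ℕ →₀ A) => evenEmbed x.1 + oddEmbed x.2) := by
  constructor
  · rintro ⟨p, q⟩ ⟨r, s⟩ h
    refine Prod.ext (Finsupp.ext fun i => ?_) (Finsupp.ext fun i => ?_)
    · simpa [evenEmbed_apply_two_mul, oddEmbed_apply_two_mul] using DFunLike.congr_fun h (2 * i)
    · simpa [evenEmbed_apply_two_mul_add_one, oddEmbed_apply_two_mul_add_one] using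
        DFunLike.congr_fun h (2 * i + 1)
  · intro f
    induction f using Finsupp.induction_linear with
    | zero => exact ⟨0, by simp⟩
    | add f g hf hg =>
      obtain ⟨x, rfl⟩ := hf
      obtain ⟨y, rfl⟩ := hg
      refine ⟨x + y, ?_⟩
      simp only [Prod.fst_add, Prod.snd_add, evenEmbed_add, oddEmbed_add]
      abel
    | single n a =>
      obtain ⟨k, rfl | rfl⟩ := n.even_or_odd'
      · exact ⟨(Finsupp.single k a, 0), by simp⟩
      · exact ⟨(0, Finsupp.single k a), by simp⟩

end Additivity

section Star

variable {A : Type*} [NonAssocRing A] [StarRing A]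

@[simp] theorem starIter_zero (m : ℕ) : starIter m (0 : A) = 0 := by
  induction m with
  | zero => rfl
  | succ m ih => rw [starIter, ih, star_zero]

theorem starIter_add (m : ℕ) (a b : A) : starIter m (a + b) = starIter m a + starIter m b := by
  induction m with
  | zero => rfl
  | succ m ih => rw [starIter, ih, star_add, starIter, starIter]

theorem starIter_two_mul (m : ℕ) (a : A) : starIter (2 * m) a = a := by
  induction m with
  | zero => rfl
  | succ m ih => rw [Nat.mul_succ, starIter, starIter, ih, star_star]

theorem starIter_two_mul_add_one (m : ℕ) (a : A) : starIter (2 * m + 1) a = star a := by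
  rw [starIter, starIter_two_mul]

@[simp] theorem pstar_zero : pstar (0 : ℕ →₀ A) = 0 := Finsupp.mapRange_zero

@[simp] theorem pstar_single (n : ℕ) (a : A) :
    pstar (Finsupp.single n a) = Finsupp.single n (star a) := Finsupp.mapRange_single

theorem pstar_add (p q : ℕ →₀ A) : pstar (p + q) = pstar p + pstar q :=
  Finsupp.mapRange_add star_add p q

@[simp] theorem alphaMap_zero : alphaMap (0 : ℕ →₀ A) = 0 := Finsupp.sum_zero_index

@[simp] theorem alphaMap_single (n : ℕ) (a : A) :
    alphaMap (Finsupp.single n a) = Finsupp.single n ((-1 : ℤ) ^ n • starIter (n + 1) a) :=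
  Finsupp.sum_single_index (by simp)

theorem alphaMap_add (p q : ℕ →₀ A) : alphaMap (p + q) = alphaMap p + alphaMap q :=
  Finsupp.sum_add_index' (by simp) fun _ _ _ => by
    rw [starIter_add, smul_add, Finsupp.single_add]

@[simp] theorem fmul_zero_left (q : ℕ →₀ A) : fmul 0 q = 0 := Finsupp.sum_zero_index

@[simp] theorem fmul_zero_right (p : ℕ →₀ A) : fmul p 0 = 0 := by simp [fmul]

theorem fmul_add_left (p p' q : ℕ →₀ A) : fmul (p + p') q = fmul p q + fmul p' q :=
  Finsupp.sum_add_index' (by simp [tau_zero_left]) fun _ _ _ => by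
    simp [tau_add_left, Finsupp.sum_add]

theorem fmul_add_right (p q q' : ℕ →₀ A) : fmul p (q + q') = fmul p q + fmul p q' := by
  unfold fmul
  rw [← Finsupp.sum_add]
  refine Finsupp.sum_congr fun m _ =>
    Finsupp.sum_add_index' (by simp [tau_zero_right]) fun _ _ _ => ?_
  rw [starIter_add, tau_add_right, Finsupp.single_add]

@[simp] theorem fmul_single (m n : ℕ) (a b : A) :
    fmul (Finsupp.single m a) (Finsupp.single n b) =
      Finsupp.single (m + n) (tau n a (starIter m b)) := by
  simp [fmul, tau_zero_left, tau_zero_right]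

theorem fmul_evenEmbed_evenEmbed (p r : ℕ →₀ A) :
    fmul (evenEmbed p) (evenEmbed r) = evenEmbed (pmul p r) := by
  induction p using Finsupp.induction_linear with
  | zero => simp
  | add p p' hp hp' => simp only [evenEmbed_add, fmul_add_left, pmul_add_left, hp, hp']
  | single m a =>
    induction r using Finsupp.induction_linear with
    | zero => simp
    | add r r' hr hr' => simp only [evenEmbed_add, fmul_add_right, pmul_add_right, hr, hr']
    | single n b =>
      simp only [evenEmbed_single, fmul_single, pmul_single, tau_two_mul, starIter_two_mul,
        Nat.mul_add]

theorem fmul_evenEmbed_oddEmbed (p s : ℕ →₀ A) :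
    fmul (evenEmbed p) (oddEmbed s) = oddEmbed (pmul s p) := by
  induction p using Finsupp.induction_linear with
  | zero => simp
  | add p p' hp hp' =>
    simp only [evenEmbed_add, oddEmbed_add, fmul_add_left, pmul_add_right, hp, hp']
  | single m a =>
    induction s using Finsupp.induction_linear with
    | zero => simp
    | add s s' hs hs' => simp only [oddEmbed_add, fmul_add_right, pmul_add_left, hs, hs']
    | single n b =>
      simp only [evenEmbed_single, oddEmbed_single, fmul_single, pmul_single,
        tau_two_mul_add_one, starIter_two_mul]
      congr 1
      ring

theorem fmul_oddEmbed_evenEmbed (q r : ℕ →₀ A) :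
    fmul (oddEmbed q) (evenEmbed r) = oddEmbed (pmul q (pstar r)) := by
  induction q using Finsupp.induction_linear with
  | zero => simp
  | add q q' hq hq' => simp only [oddEmbed_add, fmul_add_left, pmul_add_left, hq, hq']
  | single m a =>
    induction r using Finsupp.induction_linear with
    | zero => simp
    | add r r' hr hr' =>
      simp only [evenEmbed_add, oddEmbed_add, pstar_add, fmul_add_right, pmul_add_right, hr, hr']
    | single n b =>
      simp only [evenEmbed_single, oddEmbed_single, pstar_single, fmul_single, pmul_single,
        tau_two_mul, starIter_two_mul_add_one]
      congr 1
      ring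

theorem fmul_oddEmbed_oddEmbed (q s : ℕ →₀ A) :
    fmul (oddEmbed q) (oddEmbed s) = evenEmbed (tshift (pmul (pstar s) q)) := by
  induction q using Finsupp.induction_linear with
  | zero => simp
  | add q q' hq hq' =>
    simp only [evenEmbed_add, oddEmbed_add, tshift_add, fmul_add_left, pmul_add_right, hq, hq']
  | single m a =>
    induction s using Finsupp.induction_linear with
    | zero => simp
    | add s s' hs hs' =>
      simp only [evenEmbed_add, oddEmbed_add, pstar_add, tshift_add, fmul_add_right,
        pmul_add_left, hs, hs']
    | single n b =>
      simp only [evenEmbed_single, oddEmbed_single, pstar_single, tshift_single, fmul_single,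
        pmul_single, tau_two_mul_add_one, starIter_two_mul_add_one]
      congr 1
      ring

theorem alphaMap_evenEmbed (p : ℕ →₀ A) : alphaMap (evenEmbed p) = evenEmbed (pstar p) := by
  induction p using Finsupp.induction_linear with
  | zero => simp
  | add p q hp hq => simp only [evenEmbed_add, alphaMap_add, pstar_add, hp, hq]
  | single n a => simp [starIter_two_mul_add_one]

theorem alphaMap_oddEmbed (q : ℕ →₀ A) : alphaMap (oddEmbed q) = -oddEmbed q := by
  induction q using Finsupp.induction_linear with
  | zero => simp
  | add p q hp hq => rw [oddEmbed_add, alphaMap_add, hp, hq, neg_add]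
  | single n a =>
    simp [starIter, starIter_two_mul, pow_succ]

end Star

/-- the map `φ : Cay(A[t], t) → A[X;*]^fl`, `φ(p(t), q(t)) = p(X²) + q(X²)·X`,
is a bijective `K`-algebra homomorphism intertwining the involution of `Cay(A[t], t)` with
the involution `α` of `A[X;*]^fl`; in particular `Cay(A[t], t) ≅ A[X;*]^fl` as `*`-algebras. -/
theorem cayley_double_polynomial_iso
    {K A : Type*} [CommRing K] [NonAssocRing A] [Module K A]
    [SMulCommClass K A A] [IsScalarTower K A A] [StarRing A]
    (hstar : ∀ (k : K) (a : A), star (k • a) = k • star a) :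
    Function.Bijective
      (fun x : (ℕ →₀ A) × (ℕ →₀ A) => evenEmbed x.1 + oddEmbed x.2) ∧
    (∀ x y : (ℕ →₀ A) × (ℕ →₀ A),
      evenEmbed (x + y).1 + oddEmbed (x + y).2
        = (evenEmbed x.1 + oddEmbed x.2) + (evenEmbed y.1 + oddEmbed y.2)) ∧
    (∀ (k : K) (x : (ℕ →₀ A) × (ℕ →₀ A)),
      evenEmbed (k • x).1 + oddEmbed (k • x).2 = k • (evenEmbed x.1 + oddEmbed x.2)) ∧
    (evenEmbed (Finsupp.single 0 (1 : A)) + oddEmbed (0 : ℕ →₀ A) = Finsupp.single 0 (1 : A)) ∧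
    (∀ x y : (ℕ →₀ A) × (ℕ →₀ A),
      evenEmbed (cayPolyMul x y).1 + oddEmbed (cayPolyMul x y).2
        = fmul (evenEmbed x.1 + oddEmbed x.2) (evenEmbed y.1 + oddEmbed y.2)) ∧
    (∀ x : (ℕ →₀ A) × (ℕ →₀ A),
      evenEmbed (cayPolyStar x).1 + oddEmbed (cayPolyStar x).2
        = alphaMap (evenEmbed x.1 + oddEmbed x.2)) := by
  refine ⟨bijective_evenEmbed_add_oddEmbed, fun x y => ?_, fun k x => ?_, by simp,
    fun x y => ?_, fun x => ?_⟩
  · simp only [Prod.fst_add, Prod.snd_add, evenEmbed_add, oddEmbed_add]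
    abel
  · simp only [Prod.smul_fst, Prod.smul_snd, evenEmbed_smul, oddEmbed_smul, smul_add]
  · simp only [cayPolyMul, evenEmbed_add, oddEmbed_add, fmul_add_left, fmul_add_right,
      fmul_evenEmbed_evenEmbed, fmul_evenEmbed_oddEmbed, fmul_oddEmbed_evenEmbed,
      fmul_oddEmbed_oddEmbed]
    abel
  · simp only [cayPolyStar, alphaMap_add, alphaMap_evenEmbed, alphaMap_oddEmbed, oddEmbed_neg]
end

section
/- The center of B = A[X;*]^fl is Z(B) = { Σ_i a_i X^i : each a_i lies in Z_*(A) = {a ∈ Z(A) : a* = a}, and every odd-indexed coefficient satisfies a_{2i+1}·b* = a_{2i+1}·b for all b ∈ A }. -/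
theorem starIter_eq_ite {A : Type*} [NonAssocRing A] [StarRing A] (n : ℕ) (a : A) :
    starIter n a = if Even n then a else star a := by
  induction n with
  | zero => simp [starIter]
  | succ n ih =>
    by_cases h : Even n <;> simp [starIter, ih, h, Nat.even_add_one]

/-- `(a, b) ↦ τ_n(a, *^m(b)) X^{m+n}` as a biadditive map. -/
noncomputable def monomialMulHom {A : Type*} [NonAssocRing A] [StarRing A] (m n : ℕ) :
    A →+ A →+ (ℕ →₀ A) :=
  AddMonoidHom.mk' (fun a => AddMonoidHom.mk'
      (fun b => Finsupp.single (m + n) (tau n a (starIter m b)))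
      (fun b c => by
        rw [← Finsupp.single_add]
        simp only [tau, starIter_eq_ite]
        split_ifs <;> simp [mul_add, add_mul]))
    (fun a b => by
      ext1 c
      simp only [AddMonoidHom.mk'_apply, AddMonoidHom.add_apply]
      rw [← Finsupp.single_add]
      simp only [tau]
      split_ifs <;> simp [mul_add, add_mul])

/-- The multiplication `fmul` as a biadditive map. -/
noncomputable def fmulHom {A : Type*} [NonAssocRing A] [StarRing A] :
    (ℕ →₀ A) →+ (ℕ →₀ A) →+ (ℕ →₀ A) :=
  Finsupp.liftAddHom fun m =>
    AddMonoidHom.flip (Finsupp.liftAddHom fun n => (monomialMulHom m n).flip)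

theorem fmulHom_apply {A : Type*} [NonAssocRing A] [StarRing A] (p q : ℕ →₀ A) :
    fmulHom p q = fmul p q := by
  simp [fmulHom, fmul, monomialMulHom, Finsupp.sum, Finsupp.liftAddHom_apply]

theorem fmul_add {A : Type*} [NonAssocRing A] [StarRing A] (p q r : ℕ →₀ A) :
    fmul p (q + r) = fmul p q + fmul p r := by
  simp [← fmulHom_apply]

theorem add_fmul {A : Type*} [NonAssocRing A] [StarRing A] (p q r : ℕ →₀ A) :
    fmul (p + q) r = fmul p r + fmul q r := by
  simp [← fmulHom_apply]

theorem fmul_zero {A : Type*} [NonAssocRing A] [StarRing A] (p : ℕ →₀ A) :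
    fmul p 0 = 0 := by
  simp [← fmulHom_apply]

theorem zero_fmul {A : Type*} [NonAssocRing A] [StarRing A] (p : ℕ →₀ A) :
    fmul 0 p = 0 := by
  simp [← fmulHom_apply]

theorem fmul_single_single {A : Type*} [NonAssocRing A] [StarRing A] (m n : ℕ) (a b : A) :
    fmul (Finsupp.single m a) (Finsupp.single n b) =
      Finsupp.single (m + n) (tau n a (starIter m b)) := by
  rw [← fmulHom_apply]
  simp [fmulHom, monomialMulHom]

theorem fmul_single_apply {A : Type*} [NonAssocRing A] [StarRing A] (p : ℕ →₀ A) (n : ℕ)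
    (b : A) (i : ℕ) :
    fmul p (Finsupp.single n b) (i + n) = tau n (p i) (starIter i b) := by
  induction p using Finsupp.induction_linear with
  | zero => simp [zero_fmul, tau]
  | add p q hp hq =>
    simp only [add_fmul, Finsupp.add_apply, hp, hq, tau]
    split_ifs <;> simp [mul_add, add_mul]
  | single m a =>
    rw [fmul_single_single]
    by_cases h : m = i
    · subst h; simp
    · simp [h, tau]

theorem single_fmul_apply {A : Type*} [NonAssocRing A] [StarRing A] (p : ℕ →₀ A) (m : ℕ)
    (b : A) (i : ℕ) :
    fmul (Finsupp.single m b) p (i + m) = tau i b (starIter m (p i)) := by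
  induction p using Finsupp.induction_linear with
  | zero => simp [fmul_zero, tau, starIter_eq_ite]
  | add p q hp hq =>
    simp only [fmul_add, Finsupp.add_apply, hp, hq, tau, starIter_eq_ite]
    split_ifs <;> simp [mul_add, add_mul]
  | single n a =>
    rw [fmul_single_single]
    by_cases h : n = i
    · subst h; simp [add_comm]
    · simp [h, tau, starIter_eq_ite, add_comm m n]

/-- The condition on the coefficient of `X^i` of a polynomial in the center. -/
structure IsCenterCoeff {A : Type*} [NonAssocRing A] [StarRing A] (i : ℕ) (a : A) : Prop where
  comm : ∀ b : A, a * b = b * a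
  left_assoc : ∀ b c : A, (a * b) * c = a * (b * c)
  middle_assoc : ∀ b c : A, (b * a) * c = b * (a * c)
  right_assoc : ∀ b c : A, (b * c) * a = b * (c * a)
  star_eq : star a = a
  mul_star : ¬ Even i → ∀ b : A, a * star b = a * b

namespace IsCenterCoeff

variable {A : Type*} [NonAssocRing A] [StarRing A] {i : ℕ} {a : A}

theorem mul_left_comm (h : IsCenterCoeff i a) (b c : A) : b * (a * c) = a * (b * c) := by
  rw [← h.middle_assoc, ← h.comm, h.left_assoc]

theorem mul_star_mul (h : IsCenterCoeff i a) (hi : ¬ Even i) (b c : A) :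
    a * (star b * c) = a * (b * c) := by
  rw [← h.left_assoc, h.mul_star hi, h.left_assoc]

theorem mul_mul_star (h : IsCenterCoeff i a) (hi : ¬ Even i) (b c : A) :
    a * (b * star c) = a * (b * c) := by
  rw [← h.mul_left_comm, h.mul_star hi, h.mul_left_comm]

theorem mul_mul_comm (h : IsCenterCoeff i a) (hi : ¬ Even i) (b c : A) :
    a * (b * c) = a * (c * b) := by
  rw [← h.mul_star hi, star_mul, h.mul_star_mul hi, h.mul_mul_star hi]

theorem single_fmul_comm (h : IsCenterCoeff i a) (m : ℕ) (b : A) :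
    fmul (Finsupp.single i a) (Finsupp.single m b) =
      fmul (Finsupp.single m b) (Finsupp.single i a) := by
  have hc : ∀ b, b * a = a * b := fun b => (h.comm b).symm
  simp only [fmul_single_single, add_comm m i, tau, starIter_eq_ite]
  congr 1
  by_cases hi : Even i
  · by_cases hm : Even m <;> simp [hi, hm, hc, h.star_eq]
  · by_cases hm : Even m <;> simp [hi, hm, hc, h.star_eq, h.mul_star hi]

theorem single_fmul_left_assoc (h : IsCenterCoeff i a) (m n : ℕ) (b c : A) :
    fmul (fmul (Finsupp.single i a) (Finsupp.single m b)) (Finsupp.single n c) =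
      fmul (Finsupp.single i a) (fmul (Finsupp.single m b) (Finsupp.single n c)) := by
  have hc : ∀ b, b * a = a * b := fun b => (h.comm b).symm
  simp only [fmul_single_single, tau, starIter_eq_ite, add_assoc]
  congr 1
  by_cases hi : Even i
  · by_cases hm : Even m <;> by_cases hn : Even n <;>
      simp [hi, hm, hn, hc, h.left_assoc, h.mul_left_comm, Nat.even_add]
  · by_cases hm : Even m <;> by_cases hn : Even n <;>
      simp [hi, hm, hn, hc, h.left_assoc, h.mul_left_comm, h.mul_star hi, h.mul_star_mul hi,
        h.mul_mul_star hi, h.mul_mul_comm hi b c, Nat.even_add]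

theorem single_fmul_middle_assoc (h : IsCenterCoeff i a) (m n : ℕ) (b c : A) :
    fmul (fmul (Finsupp.single m b) (Finsupp.single i a)) (Finsupp.single n c) =
      fmul (Finsupp.single m b) (fmul (Finsupp.single i a) (Finsupp.single n c)) := by
  have hc : ∀ b, b * a = a * b := fun b => (h.comm b).symm
  simp only [fmul_single_single, tau, starIter_eq_ite, add_assoc]
  congr 1
  by_cases hi : Even i
  · by_cases hm : Even m <;> by_cases hn : Even n <;>
      simp [hi, hm, hn, hc, h.star_eq, h.left_assoc, h.mul_left_comm, Nat.even_add]
  · by_cases hm : Even m <;> by_cases hn : Even n <;>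
      simp [hi, hm, hn, hc, h.star_eq, h.left_assoc, h.mul_left_comm, h.mul_star hi,
        h.mul_star_mul hi, h.mul_mul_star hi, h.mul_mul_comm hi b c, Nat.even_add]

theorem single_fmul_right_assoc (h : IsCenterCoeff i a) (m n : ℕ) (b c : A) :
    fmul (fmul (Finsupp.single m b) (Finsupp.single n c)) (Finsupp.single i a) =
      fmul (Finsupp.single m b) (fmul (Finsupp.single n c) (Finsupp.single i a)) := by
  have hc : ∀ b, b * a = a * b := fun b => (h.comm b).symm
  simp only [fmul_single_single, tau, starIter_eq_ite, add_assoc]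
  congr 1
  by_cases hi : Even i
  · by_cases hm : Even m <;> by_cases hn : Even n <;>
      simp [hi, hm, hn, hc, h.star_eq, h.left_assoc, h.mul_left_comm, Nat.even_add]
  · by_cases hm : Even m <;> by_cases hn : Even n <;>
      simp [hi, hm, hn, hc, h.star_eq, h.left_assoc, h.mul_left_comm, h.mul_star hi,
        h.mul_star_mul hi, h.mul_mul_star hi, h.mul_mul_comm hi b c, Nat.even_add]

end IsCenterCoeff

theorem fmul_comm_of_isCenterCoeff {A : Type*} [NonAssocRing A] [StarRing A] {p : ℕ →₀ A}
    (hp : ∀ i, IsCenterCoeff i (p i)) (q : ℕ →₀ A) : fmul p q = fmul q p := by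
  induction q using Finsupp.induction_linear with
  | zero => rw [fmul_zero, zero_fmul]
  | add q r hq hr => rw [fmul_add, add_fmul, hq, hr]
  | single m b =>
    simp only [← fmulHom_apply]
    rw [← Finsupp.sum_single p, Finsupp.sum]
    simp only [map_sum, AddMonoidHom.finsetSum_apply, fmulHom_apply]
    exact Finset.sum_congr rfl fun i _ => (hp i).single_fmul_comm m b

theorem fmul_left_assoc_of_isCenterCoeff {A : Type*} [NonAssocRing A] [StarRing A]
    {p : ℕ →₀ A} (hp : ∀ i, IsCenterCoeff i (p i)) (q w : ℕ →₀ A) :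
    fmul (fmul p q) w = fmul p (fmul q w) := by
  induction q using Finsupp.induction_linear with
  | zero => simp only [fmul_zero, zero_fmul]
  | add q r hq hr => simp only [fmul_add, add_fmul, hq, hr]
  | single m b =>
    induction w using Finsupp.induction_linear with
    | zero => simp only [fmul_zero]
    | add q r hq hr => simp only [fmul_add, hq, hr]
    | single n c =>
      simp only [← fmulHom_apply]
      rw [← Finsupp.sum_single p, Finsupp.sum]
      simp only [map_sum, AddMonoidHom.finsetSum_apply, fmulHom_apply]
      exact Finset.sum_congr rfl fun i _ => (hp i).single_fmul_left_assoc m n b c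

theorem fmul_middle_assoc_of_isCenterCoeff {A : Type*} [NonAssocRing A] [StarRing A]
    {p : ℕ →₀ A} (hp : ∀ i, IsCenterCoeff i (p i)) (q w : ℕ →₀ A) :
    fmul (fmul q p) w = fmul q (fmul p w) := by
  induction q using Finsupp.induction_linear with
  | zero => simp only [zero_fmul]
  | add q r hq hr => simp only [add_fmul, hq, hr]
  | single m b =>
    induction w using Finsupp.induction_linear with
    | zero => simp only [fmul_zero]
    | add q r hq hr => simp only [fmul_add, hq, hr]
    | single n c =>
      simp only [← fmulHom_apply]
      rw [← Finsupp.sum_single p, Finsupp.sum]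
      simp only [map_sum, AddMonoidHom.finsetSum_apply, fmulHom_apply]
      exact Finset.sum_congr rfl fun i _ => (hp i).single_fmul_middle_assoc m n b c

theorem fmul_right_assoc_of_isCenterCoeff {A : Type*} [NonAssocRing A] [StarRing A]
    {p : ℕ →₀ A} (hp : ∀ i, IsCenterCoeff i (p i)) (q w : ℕ →₀ A) :
    fmul (fmul q w) p = fmul q (fmul w p) := by
  induction q using Finsupp.induction_linear with
  | zero => simp only [zero_fmul]
  | add q r hq hr => simp only [add_fmul, hq, hr]
  | single m b =>
    induction w using Finsupp.induction_linear with
    | zero => simp only [fmul_zero, zero_fmul]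
    | add q r hq hr => simp only [fmul_add, add_fmul, hq, hr]
    | single n c =>
      simp only [← fmulHom_apply]
      rw [← Finsupp.sum_single p, Finsupp.sum]
      simp only [map_sum, fmulHom_apply]
      exact Finset.sum_congr rfl fun i _ => (hp i).single_fmul_right_assoc m n b c

theorem isCenterCoeff_of_mem_center {A : Type*} [NonAssocRing A] [StarRing A] {p : ℕ →₀ A}
    (hc : ∀ q : ℕ →₀ A, fmul p q = fmul q p)
    (hl : ∀ q w : ℕ →₀ A, fmul (fmul p q) w = fmul p (fmul q w))
    (hm : ∀ q w : ℕ →₀ A, fmul (fmul q p) w = fmul q (fmul p w))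
    (hr : ∀ q w : ℕ →₀ A, fmul (fmul q w) p = fmul q (fmul w p)) (i : ℕ) :
    IsCenterCoeff i (p i) := by
  have hc_coeff : ∀ m b, tau m (p i) (starIter i b) = tau i b (starIter m (p i)) := fun m b => by
    rw [← fmul_single_apply, hc, single_fmul_apply]
  have hl_coeff : ∀ n b c, tau n (p i * starIter i b) (starIter i c) =
      tau n (p i) (starIter i (tau n b c)) := fun n b c => by
    have h := DFunLike.congr_fun (hl (Finsupp.single 0 b) (Finsupp.single n c)) (i + n)
    rw [fmul_single_apply, fmul_single_single, zero_add, fmul_single_apply] at h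
    have h₁ := fmul_single_apply p 0 b i
    simp only [add_zero] at h₁
    simpa [h₁, tau, starIter] using h
  have hm_coeff : ∀ b c, tau i b (p i) * starIter i c = tau i b (p i * starIter i c) :=
    fun b c => by
    have h := DFunLike.congr_fun (hm (Finsupp.single 0 b) (Finsupp.single 0 c)) (i + 0)
    rw [fmul_single_apply, single_fmul_apply] at h
    have h₁ := single_fmul_apply p 0 b i
    have h₂ := fmul_single_apply p 0 c i
    simp only [add_zero] at h₁ h₂
    simpa [h₁, h₂, tau, starIter] using h
  have hr_coeff : ∀ b c, tau i (b * c) (p i) = tau i b (tau i c (p i)) := fun b c => by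
    have h := DFunLike.congr_fun (hr (Finsupp.single 0 b) (Finsupp.single 0 c)) (i + 0)
    have h₁ := single_fmul_apply p 0 c i
    rw [fmul_single_single, single_fmul_apply, single_fmul_apply] at h
    simp only [add_zero] at h₁
    simpa [h₁, tau, starIter] using h
  have hstar : star (p i) = p i := by
    simpa [tau, starIter_eq_ite] using (hc_coeff 1 1).symm
  by_cases hi : Even i
  · simp only [starIter_eq_ite, hi, if_true, tau] at hc_coeff hl_coeff hm_coeff hr_coeff
    exact
      { comm := fun b => by simpa using hc_coeff 0 b
        left_assoc := fun b c => by simpa using hl_coeff 0 b c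
        middle_assoc := hm_coeff
        right_assoc := hr_coeff
        star_eq := hstar
        mul_star := fun h => absurd hi h }
  · simp only [starIter_eq_ite, hi, if_false, tau, hstar, ite_self] at hc_coeff hl_coeff hm_coeff
    have mul_star : ∀ b, p i * star b = p i * b := fun b => by simpa using hc_coeff 0 b
    have comm : ∀ b, p i * b = b * p i := fun b => by
      simpa [mul_star] using (hc_coeff 1 (star b)).symm
    have mul_mul_eq : ∀ b c, p i * b * c = p i * c * b := fun b c => by
      simpa [mul_star] using hm_coeff b (star c)
    have mul_mul_eq' : ∀ b c, p i * b * c = p i * (c * b) := fun b c => by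
      simpa [mul_star] using hl_coeff 0 (star b) (star c)
    have mul_mul_eq'' : ∀ b c, c * (p i * b) = p i * (b * c) := fun b c => by
      simpa [mul_star, ← comm] using hl_coeff 1 (star b) (star c)
    have left_assoc : ∀ b c, p i * b * c = p i * (b * c) := fun b c => by
      rw [mul_mul_eq, mul_mul_eq']
    exact
      { comm := comm
        left_assoc := left_assoc
        middle_assoc := fun b c => by rw [← comm, mul_mul_eq'', mul_mul_eq']
        right_assoc := fun b c => by rw [← comm, ← comm, mul_mul_eq'', ← mul_mul_eq', left_assoc]
        star_eq := hstar
        mul_star := fun _ => mul_star }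

/-- the center of `B = A[X;*]^fl` consists of the polynomials `Σ_i a_i X^i`
whose coefficients all lie in `Z_*(A) = {a ∈ Z(A) : a* = a}` and whose odd-indexed
coefficients satisfy `a_{2i+1} b* = a_{2i+1} b` for all `b ∈ A`. (The center is the set of
elements of the commuter that also lie in all three nuclei.) -/
theorem center_flipped_skew_polynomial_ring
    {A : Type*} [NonAssocRing A] [StarRing A] :
    ∀ p : ℕ →₀ A,
      ((∀ q : ℕ →₀ A, fmul p q = fmul q p) ∧
       (∀ q w : ℕ →₀ A, fmul (fmul p q) w = fmul p (fmul q w)) ∧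
       (∀ q w : ℕ →₀ A, fmul (fmul q p) w = fmul q (fmul p w)) ∧
       (∀ q w : ℕ →₀ A, fmul (fmul q w) p = fmul q (fmul w p))) ↔
        ((∀ i : ℕ,
            (∀ b : A, p i * b = b * p i) ∧
            (∀ b c : A, (p i * b) * c = p i * (b * c)) ∧
            (∀ b c : A, (b * p i) * c = b * (p i * c)) ∧
            (∀ b c : A, (b * c) * p i = b * (c * p i)) ∧
            star (p i) = p i) ∧
         (∀ (i : ℕ) (b : A), p (2 * i + 1) * star b = p (2 * i + 1) * b)) := by
  intro p
  constructor
  · rintro ⟨hc, hl, hm, hr⟩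
    have h := fun i => isCenterCoeff_of_mem_center hc hl hm hr i
    exact ⟨fun i => ⟨(h i).comm, (h i).left_assoc, (h i).middle_assoc, (h i).right_assoc,
      (h i).star_eq⟩, fun i => (h (2 * i + 1)).mul_star (by simp)⟩
  · rintro ⟨h, hs⟩
    have hp : ∀ i, IsCenterCoeff i (p i) := fun i =>
      { comm := (h i).1
        left_assoc := (h i).2.1
        middle_assoc := (h i).2.2.1
        right_assoc := (h i).2.2.2.1
        star_eq := (h i).2.2.2.2
        mul_star := fun hi => by
          obtain ⟨k, rfl⟩ := Nat.not_even_iff_odd.1 hi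
          exact hs k }
    exact ⟨fmul_comm_of_isCenterCoeff hp, fmul_left_assoc_of_isCenterCoeff hp,
      fmul_middle_assoc_of_isCenterCoeff hp, fmul_right_assoc_of_isCenterCoeff hp⟩
end
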